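/- Let K be a compact Hausdorff space. A holomorphic function of bounded type f : C(K) → ℂ is orthogonally additive if and only if there exist a finite positive Borel measure μ on K and functions g_k ∈ L¹(μ) for k ≥ 1 with ∑_{k≥1} ‖g_k‖_{L¹(μ)} r^k < ∞ for every r > 0, such that f(x) = ∫_K ∑_{k≥1} g_k(t) x(t)^k dμ(t) for all x ∈ C(K) (the series ∑_k g_k x^k converging absolutely in L¹(μ) for every x). -/

import Mathlib

open MeasureTheory Filter Topology

/-- `f` is orthogonally additive when it is additive on orthogonal pairs. -/
def IsOrthAdd {K : Type*} [TopologicalSpace K] [CompactSpace K]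
    (f : C(K, ℂ) → ℂ) : Prop :=
  ∀ x y : C(K, ℂ), x * y = 0 → f (x + y) = f x + f y


def HB {E F : Type*} [NormedAddCommGroup E] [NormedSpace ℂ E] [NormedAddCommGroup F]
    [NormedSpace ℂ F] (f : E → F) : Prop :=
  Differentiable ℂ f ∧ ∀ r : ℝ, 0 < r → ∃ C : ℝ, ∀ x : E, ‖x‖ ≤ r → ‖f x‖ ≤ C

section HB
variable {E F : Type*} [NormedAddCommGroup E] [NormedSpace ℂ E] [NormedAddCommGroup F]
    [NormedSpace ℂ F]

lemma cauchyE {u : E → F} (hu : Differentiable ℂ u) {y : E} {M : ℝ}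
    (hM : ∀ z, ‖z - y‖ ≤ 1 → ‖u z‖ ≤ M) : ‖fderiv ℂ u y‖ ≤ M := by
  have hM0 : 0 ≤ M := (norm_nonneg _).trans (hM y (by simp))
  have key : ∀ h : E, ‖h‖ ≤ 1 → ‖fderiv ℂ u y h‖ ≤ M := by
    intro h hh
    have h1 : HasDerivAt (fun ζ : ℂ => u (y + ζ • h)) (fderiv ℂ u y h) 0 := by
      have h2 : HasDerivAt (fun ζ : ℂ => y + ζ • h) h 0 := by
        simpa using ((hasDerivAt_id (0:ℂ)).smul_const h).const_add y
      have h3 : HasFDerivAt u (fderiv ℂ u y) (y + (0:ℂ) • h) := by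
        simpa using (hu y).hasFDerivAt
      exact h3.comp_hasDerivAt (0:ℂ) h2
    rw [← h1.deriv]
    have := Complex.norm_deriv_le_of_forall_mem_sphere_norm_le (c := 0) (R := 1) (C := M)
      (f := fun ζ : ℂ => u (y + ζ • h)) one_pos (Differentiable.diffContOnCl (by fun_prop)) ?_
    · simpa using this
    · intro z hz
      apply hM
      have : ‖z‖ = 1 := by simpa using hz
      simp [norm_smul, this, hh]
  refine ContinuousLinearMap.opNorm_le_bound _ hM0 fun h => ?_
  by_cases h0 : h = 0
  · simp [h0]
  have hn : (‖h‖ : ℂ) ≠ 0 := by simpa using h0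
  have := key ((‖h‖ : ℂ)⁻¹ • h) (by simp [norm_smul, h0])
  rw [map_smul, norm_smul] at this
  have h4 : 0 < ‖h‖ := norm_pos_iff.mpr h0
  simp only [norm_inv, Complex.norm_real, norm_norm] at this
  rw [inv_mul_le_iff₀ h4] at this
  linarith

lemma HB.lip {f : E → F} (hf : HB f) (r : ℝ) (hr : 0 < r) :
    ∃ C : ℝ, 0 ≤ C ∧ (∀ x, ‖x‖ ≤ r → ‖fderiv ℂ f x‖ ≤ C) ∧
    (∀ a b, ‖a‖ ≤ r → ‖b‖ ≤ r → ‖f a - f b‖ ≤ C * ‖a - b‖) ∧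
    (∀ a b, ‖a‖ ≤ r → ‖b‖ ≤ r → ‖fderiv ℂ f a - fderiv ℂ f b‖ ≤ C * ‖a - b‖) ∧
    (∀ a b, ‖a‖ ≤ r → ‖b‖ ≤ r → ‖f b - f a - fderiv ℂ f a (b - a)‖ ≤ C * ‖b - a‖ ^ 2) := by
  obtain ⟨C, hC⟩ := hf.2 (r + 2) (by linarith)
  have hC0 : 0 ≤ C := (norm_nonneg _).trans (hC 0 (by simp; linarith))
  have h1 : ∀ x, ‖x‖ ≤ r + 1 → ‖fderiv ℂ f x‖ ≤ C := fun x hx =>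
    cauchyE hf.1 fun z hz => hC z (by
      have := norm_add_le (z - x) x
      rw [sub_add_cancel] at this; linarith)
  let _ : NormedSpace ℝ E := NormedSpace.restrictScalars ℝ ℂ E
  have h2 : ∀ a b, ‖a‖ ≤ r + 1 → ‖b‖ ≤ r + 1 → ‖f a - f b‖ ≤ C * ‖a - b‖ := by
    intro a b ha hb
    exact Convex.norm_image_sub_le_of_norm_fderiv_le (𝕜 := ℂ) (s := Metric.closedBall (0:E) (r+1))
      (fun x _ => hf.1 x) (fun x hx => h1 x (by simpa using hx)) (convex_closedBall _ _)
      (by simpa using hb) (by simpa using ha)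
  have h3 : ∀ a b, ‖a‖ ≤ r → ‖b‖ ≤ r → ‖fderiv ℂ f a - fderiv ℂ f b‖ ≤ C * ‖a - b‖ := by
    intro a b ha hb
    have hd := hf.1
    have h5 : fderiv ℂ (fun z => f (z + a) - f (z + b)) 0 = fderiv ℂ f a - fderiv ℂ f b := by
      rw [fderiv_fun_sub (by fun_prop) (by fun_prop), fderiv_comp_add_right, fderiv_comp_add_right]
      simp
    rw [← h5]
    refine cauchyE (by fun_prop) fun z hz => ?_
    rw [sub_zero] at hz
    have := h2 (z + a) (z + b) ((norm_add_le _ _).trans (by linarith))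
      ((norm_add_le _ _).trans (by linarith))
    simpa using this
  refine ⟨C, hC0, fun x hx => h1 x (by linarith), fun a b ha hb => h2 a b (by linarith) (by linarith),
    h3, ?_⟩
  intro a b ha hb
  have := Convex.norm_image_sub_le_of_norm_fderiv_le' (𝕜 := ℂ) (f := f)
    (s := Metric.closedBall (0:E) r ∩ Metric.closedBall a ‖b - a‖) (φ := fderiv ℂ f a) (x := a) (y := b)
    (C := C * ‖b - a‖)
      (fun x _ => hf.1 x) (fun x hx => ?_) ((convex_closedBall _ _).inter (convex_closedBall _ _))
      (by simpa using ha) ⟨by simpa using hb, by simp [dist_eq_norm]⟩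
  · calc _ ≤ _ := this
      _ = _ := by ring
  · refine (h3 x a (by simpa using hx.1) ha).trans ?_
    gcongr
    simpa [dist_eq_norm] using hx.2

lemma HB.cont_fderiv {f : E → F} (hf : HB f) : Continuous (fderiv ℂ f) := by
  rw [continuous_iff_continuousAt]
  intro x
  obtain ⟨C, hC0, -, -, h, -⟩ := hf.lip (‖x‖ + 1) (by positivity)
  rw [ContinuousAt, tendsto_iff_norm_sub_tendsto_zero]
  have hl : Tendsto (fun y => C * ‖y - x‖) (𝓝 x) (𝓝 0) := by
    have : Continuous (fun y => C * ‖y - x‖) := by fun_prop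
    simpa using this.tendsto x
  refine squeeze_zero' (Eventually.of_forall fun _ => norm_nonneg _) ?_ hl
  filter_upwards [Metric.ball_mem_nhds x one_pos] with y hy
  apply h _ _ _ (by linarith)
  have := norm_add_le (y - x) x
  rw [sub_add_cancel] at this
  rw [mem_ball_iff_norm] at hy
  linarith

lemma HB.diff_apply [CompleteSpace F] {f : E → F} (hf : HB f) (h : E) :
    Differentiable ℂ (fun y => fderiv ℂ f y h) := by
  have hd := hf.1
  have hc := hf.cont_fderiv
  have hcf : Continuous f := hd.continuous
  have key : ∀ y, fderiv ℂ f y h = (2 * Real.pi * Complex.I : ℂ)⁻¹ •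
      ∮ ζ in C(0, 1), (ζ ^ 2)⁻¹ • f (y + ζ • h) := by
    intro y
    have h1 : HasDerivAt (fun ζ : ℂ => f (y + ζ • h)) (fderiv ℂ f y h) 0 := by
      have h2 : HasDerivAt (fun ζ : ℂ => y + ζ • h) h 0 := by
        simpa using ((hasDerivAt_id (0:ℂ)).smul_const h).const_add y
      have h3 : HasFDerivAt f (fderiv ℂ f y) (y + (0:ℂ) • h) := by
        simpa using (hd y).hasFDerivAt
      exact h3.comp_hasDerivAt (0:ℂ) h2
    rw [← h1.deriv]
    have := Complex.two_pi_I_inv_smul_circleIntegral_sub_sq_inv_smul_of_differentiable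
      (f := fun ζ : ℂ => f (y + ζ • h)) (U := Set.univ) (c := 0) (R := 1) (w₀ := 0) isOpen_univ
      (Set.subset_univ _) (Differentiable.differentiableOn (by fun_prop)) (by simp)
    rw [← this]
    simp
  simp_rw [key]
  apply Differentiable.const_smul
  intro y
  obtain ⟨C, hC0, hC, -, -, -⟩ := hf.lip (‖y‖ + 1 + ‖h‖) (by positivity)
  unfold circleIntegral
  have hcm : Continuous (fun θ : ℝ => circleMap (0:ℂ) 1 θ) := continuous_circleMap _ _
  have hne : ∀ θ : ℝ, circleMap (0:ℂ) 1 θ ^ 2 ≠ 0 := fun θ => by simp [circleMap]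
  have hn : ∀ θ : ℝ, ‖circleMap (0:ℂ) 1 θ‖ = 1 := fun θ => by simp
  refine (intervalIntegral.hasFDerivAt_integral_of_dominated_of_fderiv_le (𝕜 := ℂ)
    (s := Metric.ball y 1) (bound := fun _ => C)
    (F' := fun y θ => deriv (circleMap (0:ℂ) 1) θ • (circleMap (0:ℂ) 1 θ ^ 2)⁻¹ •
      fderiv ℂ f (y + circleMap (0:ℂ) 1 θ • h))
    (Metric.ball_mem_nhds y one_pos) ?_ ?_ ?_ ?_ ?_ ?_).differentiableAt
  · refine Eventually.of_forall fun z => Continuous.aestronglyMeasurable ?_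
    simp only [deriv_circleMap]
    exact (hcm.mul continuous_const).smul (((hcm.pow 2).inv₀ hne).smul (by fun_prop))
  · refine Continuous.intervalIntegrable ?_ _ _
    simp only [deriv_circleMap]
    exact (hcm.mul continuous_const).smul (((hcm.pow 2).inv₀ hne).smul (by fun_prop))
  · refine Continuous.aestronglyMeasurable ?_
    simp only [deriv_circleMap]
    exact (hcm.mul continuous_const).smul (((hcm.pow 2).inv₀ hne).smul (by fun_prop))
  · refine Eventually.of_forall fun θ _ z hz => ?_
    simp only [deriv_circleMap, norm_smul, norm_mul, norm_inv, norm_pow, hn, Complex.norm_I]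
    simp only [one_mul, one_pow, inv_one]
    apply hC
    have h1 := norm_add_le (z - y) y
    rw [sub_add_cancel] at h1
    rw [mem_ball_iff_norm] at hz
    refine (norm_add_le _ _).trans ?_
    rw [norm_smul, hn]; linarith
  · simp
  · refine Eventually.of_forall fun θ _ z hz => ?_
    refine HasFDerivAt.const_smul (HasFDerivAt.const_smul ?_ _) _
    have : HasFDerivAt f (fderiv ℂ f (z + circleMap (0:ℂ) 1 θ • h)) (z + circleMap (0:ℂ) 1 θ • h) :=
      (hd _).hasFDerivAt
    exact (hasFDerivAt_comp_add_right _).mpr this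

lemma HB.fderiv [CompleteSpace F] {f : E → F} (hf : HB f) : HB (fderiv ℂ f) := by
  have hd := hf.1
  refine ⟨fun z => ?_, fun r hr => ?_⟩
  swap
  · obtain ⟨C, -, h, -⟩ := hf.lip r hr
    exact ⟨C, h⟩
  obtain ⟨C, hC0, hC, -, -, hT⟩ := hf.lip (‖z‖ + 2) (by positivity)
  have hda := hf.diff_apply
  let L : E →L[ℂ] (E →L[ℂ] F) := LinearMap.mkContinuous
    { toFun := fun k => _root_.fderiv ℂ (fun y => _root_.fderiv ℂ f y k) z
      map_add' := fun k l => by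
        simp only [map_add]
        exact fderiv_fun_add (hda k z) (hda l z)
      map_smul' := fun c k => by
        simp only [map_smul, RingHom.id_apply]
        exact fderiv_fun_const_smul (hda k z) c } C (by
    intro k
    refine cauchyE (hda k) fun y hy => ?_
    refine (ContinuousLinearMap.le_opNorm _ _).trans ?_
    gcongr
    apply hC
    have h1 := norm_add_le (y - z) z
    rw [sub_add_cancel] at h1
    linarith)
  have hL : ∀ k, L k = _root_.fderiv ℂ (fun y => _root_.fderiv ℂ f y k) z := fun k => rfl
  refine (HasFDerivAt.of_isLittleO (f' := L) ?_).differentiableAt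
  have hest : ∀ᶠ x' in 𝓝 z, ‖_root_.fderiv ℂ f x' - _root_.fderiv ℂ f z - L (x' - z)‖ ≤
      C * ‖x' - z‖ ^ 2 := by
    filter_upwards [Metric.ball_mem_nhds z one_pos] with y hy
    rw [mem_ball_iff_norm] at hy
    set k := y - z with hk
    have e : _root_.fderiv ℂ (fun x => f (x + k) - f x - _root_.fderiv ℂ f x k) z
        = _root_.fderiv ℂ f y - _root_.fderiv ℂ f z - L k := by
      rw [fderiv_fun_sub (by fun_prop) (hda k z), fderiv_fun_sub (by fun_prop) (by fun_prop),
        fderiv_comp_add_right, hL, hk]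
      simp
    rw [← e]
    refine cauchyE (((by fun_prop : Differentiable ℂ (fun x => f (x + k) - f x))).fun_sub (hda k)) fun x hx => ?_
    have h1 := norm_add_le (x - z) z
    rw [sub_add_cancel] at h1
    have := hT x (x + k) (by linarith) ((norm_add_le _ _).trans (by linarith))
    simpa using this
  rw [Asymptotics.isLittleO_iff]
  intro ε hε
  filter_upwards [hest, Metric.ball_mem_nhds z (show 0 < ε / (C + 1) by positivity)] with y hy hy2
  refine hy.trans ?_
  rw [mem_ball_iff_norm, lt_div_iff₀ (by positivity)] at hy2
  nlinarith [norm_nonneg (y - z)]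

end HB

universe u in
lemma HB.contDiff_aux {E : Type u} [NormedAddCommGroup E] [NormedSpace ℂ E] (n : ℕ) :
    ∀ {F : Type u} [NormedAddCommGroup F] [NormedSpace ℂ F] [CompleteSpace F]
    {f : E → F}, HB f → ContDiff ℂ n f := by
  induction n with
  | zero =>
    intro F _ _ _ f hf
    exact contDiff_zero.mpr hf.1.continuous
  | succ n ih =>
    intro F _ _ _ f hf
    push_cast
    rw [contDiff_succ_iff_fderiv]
    exact ⟨hf.1, fun h => by simp at h, ih hf.fderiv⟩

lemma HB.contDiff {E : Type*} [NormedAddCommGroup E] [NormedSpace ℂ E] {f : E → ℂ} (hf : HB f)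
    (n : ℕ) : ContDiff ℂ n f := by
  have : ContDiff ℂ (n + 1) f := by
    rw [contDiff_succ_iff_fderiv]
    exact ⟨hf.1, fun h => by simp at h, HB.contDiff_aux n hf.fderiv⟩
  exact this.of_le (by norm_cast; omega)


lemma pl_half {F : ℂ → ℂ} (hF : Differentiable ℂ F) {C : ℝ}
    (him : ∀ s : ℝ, ‖F (s * Complex.I)‖ ≤ C)
    (hg : ∀ ε : ℝ, 0 < ε → ∃ D : ℝ, ∀ z, ‖F z‖ ≤ D * Real.exp (ε * ‖z‖)) (z : ℂ) (hz : 0 ≤ z.re) :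
    ‖F z‖ ≤ C := by
  have h1 : ∀ ε : ℝ, 0 < ε → ‖F z‖ ≤ C * Real.exp (ε * z.re) := by
    intro ε hε
    obtain ⟨D, hD⟩ := hg ε hε
    have hD0 : 0 ≤ D := by
      have := (norm_nonneg _).trans (hD 0)
      simpa using this
    have := PhragmenLindelof.right_half_plane_of_bounded_on_real (C := C) (z := z)
      (f := fun z => F z * Complex.exp (-ε * z)) (Differentiable.diffContOnCl (by fun_prop))
      ⟨1, by norm_num, ε, ?_⟩ ?_ ?_ hz
    · rw [norm_mul, Complex.norm_exp] at this
      have e : (-(ε:ℂ) * z).re = -(ε * z.re) := by simp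
      rw [e, Real.exp_neg, ← div_eq_mul_inv, div_le_iff₀ (Real.exp_pos _)] at this
      exact this
    · refine Asymptotics.IsBigO.of_bound D ?_
      refine eventually_inf_principal.mpr (Eventually.of_forall fun w hw => ?_)
      rw [norm_mul, Complex.norm_exp, Real.norm_of_nonneg (Real.exp_pos _).le, Real.rpow_one]
      have e : (-(ε:ℂ) * w).re ≤ 0 := by
        have : 0 < w.re := hw
        simp; positivity
      calc _ ≤ ‖F w‖ * 1 := by gcongr; exact Real.exp_le_one_iff.mpr e
        _ ≤ _ := by rw [mul_one]; exact hD w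
    · refine ⟨D, ?_⟩
      rw [eventually_map]
      filter_upwards [eventually_ge_atTop 0] with x hx
      rw [norm_mul, Complex.norm_exp]
      have e : (-(ε:ℂ) * x).re = -(ε * x) := by simp
      rw [e, Real.exp_neg, ← div_eq_mul_inv, div_le_iff₀ (Real.exp_pos _)]
      simpa [abs_of_nonneg hx] using hD x
    · intro x
      rw [norm_mul, Complex.norm_exp]
      have e : (-(ε:ℂ) * (x * Complex.I)).re = 0 := by simp
      rw [e]; simpa using him x
  have h2 : Tendsto (fun ε : ℝ => C * Real.exp (ε * z.re)) (𝓝[>] 0) (𝓝 C) := by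
    have : Continuous (fun ε : ℝ => C * Real.exp (ε * z.re)) := by fun_prop
    have h3 := this.tendsto 0
    simp at h3
    exact h3.mono_left nhdsWithin_le_nhds
  refine ge_of_tendsto h2 ?_
  filter_upwards [self_mem_nhdsWithin] with ε hε using h1 ε hε

lemma pl_const {F : ℂ → ℂ} (hF : Differentiable ℂ F) {C : ℝ}
    (him : ∀ s : ℝ, ‖F (s * Complex.I)‖ ≤ C)
    (hg : ∀ ε : ℝ, 0 < ε → ∃ D : ℝ, ∀ z, ‖F z‖ ≤ D * Real.exp (ε * ‖z‖)) (z w : ℂ) :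
    F z = F w := by
  refine hF.apply_eq_apply_of_bounded ?_ z w
  rw [isBounded_iff_forall_norm_le]
  refine ⟨C, ?_⟩
  rintro _ ⟨z, rfl⟩
  rcases le_total 0 z.re with h | h
  · exact pl_half hF him hg z h
  · have := pl_half (F := fun z => F (-z)) (C := C) (by fun_prop)
      (fun s => by simpa using him (-s)) (fun ε hε => by
        obtain ⟨D, hD⟩ := hg ε hε
        exact ⟨D, fun z => by simpa using hD (-z)⟩) (-z) (by simpa using h)
    simpa using this

def SplitVanish {K : Type*} [TopologicalSpace K] [CompactSpace K] {n : ℕ}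
    (A : ContinuousMultilinearMap ℂ (fun _ : Fin n => C(K, ℂ)) ℂ) : Prop :=
  ∀ (S : Finset (Fin n)) (x : Fin n → C(K, ℂ)) (i₀ j₀ : Fin n), i₀ ∈ S → j₀ ∉ S →
    (∀ i ∈ S, ∀ j ∉ S, x i * x j = 0) → A x = 0

lemma splitVanish_iteratedFDeriv {K : Type*} [TopologicalSpace K] [CompactSpace K]
    {f : C(K, ℂ) → ℂ} (hf : HB f) (ho : IsOrthAdd f) (n : ℕ) :
    SplitVanish (iteratedFDeriv ℂ n f 0) := by
  intro S x i₀ j₀ hi₀ hj₀ hx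
  have hc := hf.contDiff n
  let gT : Finset (Fin n) → (Fin n → ℂ) →L[ℂ] C(K, ℂ) := fun T =>
    ∑ i ∈ T, (ContinuousLinearMap.proj (R := ℂ) (φ := fun _ : Fin n => ℂ) i).smulRight (x i)
  have hgT : ∀ T ζ, gT T ζ = ∑ i ∈ T, ζ i • x i := fun T ζ => by
    simp [gT]
  have hsing : ∀ T j, gT T (Pi.single j 1) = if j ∈ T then x j else 0 := by
    intro T j
    rw [hgT]
    simp [Pi.single_apply]
  have h1 : f ∘ gT Finset.univ = f ∘ gT S + f ∘ gT Sᶜ := by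
    ext1 ζ
    simp only [Function.comp, Pi.add_apply]
    rw [← ho]
    · congr 1
      simp only [hgT]
      rw [Finset.sum_add_sum_compl]
    · rw [hgT, hgT, Finset.sum_mul_sum]
      refine Finset.sum_eq_zero fun i hi => Finset.sum_eq_zero fun j hj => ?_
      rw [smul_mul_smul_comm, hx i hi j (Finset.mem_compl.mp hj), smul_zero]
  have h2 : ∀ T, iteratedFDeriv ℂ n (f ∘ gT T) 0 (fun j => Pi.single j 1)
      = iteratedFDeriv ℂ n f 0 (fun j => if j ∈ T then x j else 0) := by
    intro T
    rw [(gT T).iteratedFDeriv_comp_right hc 0 le_rfl]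
    simp [hsing]
  have h3 := h2 Finset.univ
  rw [h1, iteratedFDeriv_add (hc.comp (gT S).contDiff) (hc.comp (gT Sᶜ).contDiff), Pi.add_apply,
    ContinuousMultilinearMap.add_apply, h2, h2] at h3
  rw [ContinuousMultilinearMap.map_coord_zero _ j₀ (by simp [hj₀]),
    ContinuousMultilinearMap.map_coord_zero _ i₀ (by simp [hi₀])] at h3
  simpa using h3.symm


section Transfer
set_option linter.unusedSectionVars false
variable {K : Type*} [TopologicalSpace K] [CompactSpace K]

lemma exp_apply_CK (b : C(K, ℂ)) (t : K) : (NormedSpace.exp b) t = Complex.exp (b t) := by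
  have h := NormedSpace.map_exp (𝔹 := ℂ) (ContinuousMap.evalAlgHom ℂ ℂ t) (by
    exact continuous_eval_const t) b
  rw [Complex.exp_eq_exp_ℂ]
  exact h

/-- ramp -/
noncomputable def ramp (s : ℝ) : ℝ := max 0 (min s 1)

lemma ramp_of_le {s : ℝ} (h : s ≤ 0) : ramp s = 0 := by
  unfold ramp; rw [max_eq_left]; exact (min_le_left _ _).trans h

lemma ramp_of_ge {s : ℝ} (h : 1 ≤ s) : ramp s = 1 := by
  unfold ramp; rw [min_eq_right h]; simp

lemma ramp_nonneg (s : ℝ) : 0 ≤ ramp s := le_max_left _ _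
lemma ramp_le_one (s : ℝ) : ramp s ≤ 1 := by unfold ramp; simp

lemma ramp_cont : Continuous ramp := by unfold ramp; fun_prop

/-- bump -/
noncomputable def bmp (s : C(K, ℝ)) (m : ℕ) : C(K, ℂ) :=
  ⟨fun t => ((ramp (s t - m + 1) - ramp (s t - (m + 1 : ℕ) + 1) : ℝ) : ℂ), by
    have := ramp_cont
    fun_prop⟩

lemma bmp_sum (s : C(K, ℝ)) (N : ℕ) (h0 : ∀ t, 0 ≤ s t) (hN : ∀ t, s t ≤ N) :
    ∑ m ∈ Finset.range (N + 1), bmp s m = 1 := by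
  ext t
  rw [ContinuousMap.coe_sum, Finset.sum_apply]
  simp only [bmp, ContinuousMap.coe_mk, ContinuousMap.one_apply]
  rw [← Complex.ofReal_sum, Finset.sum_range_sub' (fun m : ℕ => ramp (s t - m + 1))]
  rw [ramp_of_ge, ramp_of_le]
  · simp
  · push_cast; linarith [hN t]
  · push_cast; linarith [h0 t]

lemma bmp_ne {s : C(K, ℝ)} {m : ℕ} {t : K} (h : bmp s m t ≠ 0) : |s t - m| < 1 := by
  contrapose! h
  simp only [bmp, ContinuousMap.coe_mk]
  rcases le_abs.mp h with h | h
  · rw [ramp_of_ge, ramp_of_ge]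
    · simp
    · push_cast; linarith
    · linarith
  · rw [ramp_of_le, ramp_of_le]
    · simp
    · push_cast; linarith
    · linarith

lemma bmp_norm (s : C(K, ℝ)) (m : ℕ) (t : K) : ‖bmp s m t‖ ≤ 1 := by
  simp only [bmp, ContinuousMap.coe_mk, Complex.norm_real, Real.norm_eq_abs]
  rw [abs_le]
  constructor <;>
  linarith [ramp_nonneg (s t - m + 1), ramp_le_one (s t - m + 1),
    ramp_nonneg (s t - (m + 1 : ℕ) + 1), ramp_le_one (s t - (m + 1 : ℕ) + 1)]

/-- complexification of a real function -/
noncomputable def cof (w : C(K, ℝ)) : C(K, ℂ) := ⟨fun t => (w t : ℂ), by fun_prop⟩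

@[simp] lemma cof_apply (w : C(K, ℝ)) (t : K) : cof w t = (w t : ℂ) := rfl

lemma term_bound {n : ℕ} (i₀ : Fin n) {A : ContinuousMultilinearMap ℂ (fun _ : Fin n => C(K, ℂ)) ℂ}
    (hA : SplitVanish A) (w s : C(K, ℝ)) (x : Fin n → C(K, ℂ)) (c : Fin n → ℝ)
    (hc : ∑ l, c l = 0) (hc1 : ∀ l, |c l| ≤ 1) (δ M : ℝ) (hδ : 0 < δ)
    (hs : ∀ t, w t = δ * s t - M) (r : Fin n → ℕ) (z : ℂ) :
    ‖A (fun l => NormedSpace.exp (z • (c l : ℂ) • cof w) * (bmp s (r l) * x l))‖ ≤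
      ‖A‖ * ∏ l, (Real.exp (‖z‖ * ((n + 1) * δ)) * ‖x l‖) := by
  by_cases hcase : ∃ j k, r j + n < r k
  · obtain ⟨j, k, hjk⟩ := hcase
    obtain ⟨q, hq, hq2⟩ : ∃ q ∈ Finset.Icc (r j) (r k), q ∉ Finset.univ.image r := by
      by_contra! hcon
      have h1 := Finset.card_le_card (show Finset.Icc (r j) (r k) ⊆ Finset.univ.image r from hcon)
      have h2 : (Finset.univ.image r).card ≤ n := Finset.card_image_le.trans (by simp)
      rw [Nat.card_Icc] at h1
      omega
    have hq3 : ∀ l, r l ≠ q := fun l hl => hq2 (by simp [← hl])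
    rw [Finset.mem_Icc] at hq
    rw [hA (Finset.univ.filter fun l => r l < q) _ j k]
    · simp; positivity
    · simp; have := hq3 j; omega
    · simp; omega
    · intro a ha b hb
      simp only [Finset.mem_filter, Finset.mem_univ, true_and, not_lt] at ha hb
      have hb' := hq3 b
      have h0 : bmp s (r a) * bmp s (r b) = 0 := by
        ext t
        rw [ContinuousMap.mul_apply, ContinuousMap.zero_apply]
        by_contra hne
        have h1 := abs_lt.mp (bmp_ne (left_ne_zero_of_mul hne))
        have h2 := abs_lt.mp (bmp_ne (right_ne_zero_of_mul hne))
        have h3 : (r a : ℝ) + 2 ≤ r b := by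
          have : r a + 2 ≤ r b := by omega
          exact_mod_cast this
        linarith
      linear_combination (NormedSpace.exp (z • (c a : ℂ) • cof w) * x a *
        (NormedSpace.exp (z • (c b : ℂ) • cof w) * x b)) * h0
  · push Not at hcase
    set c0 : ℝ := δ * r i₀ - M with hc0
    let y : Fin n → C(K, ℂ) := fun l =>
      NormedSpace.exp (z • (c l : ℂ) • cof (w - ContinuousMap.const K c0)) * (bmp s (r l) * x l)
    have e1 : (fun l => NormedSpace.exp (z • (c l : ℂ) • cof w) * (bmp s (r l) * x l)) =
        fun l => Complex.exp (z * c l * c0) • y l := by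
      ext l t
      simp only [y, ContinuousMap.mul_apply, exp_apply_CK, ContinuousMap.smul_apply, smul_eq_mul,
        cof_apply, ContinuousMap.sub_apply, ContinuousMap.const_apply]
      rw [← mul_assoc (Complex.exp (z * c l * c0)), ← Complex.exp_add]
      congr 2
      push_cast; ring
    rw [e1, ContinuousMultilinearMap.map_smul_univ, ← Complex.exp_sum]
    have e2 : ∑ l, z * (c l : ℂ) * c0 = 0 := by
      rw [← Finset.sum_mul, ← Finset.mul_sum, ← Complex.ofReal_sum, hc]; simp
    rw [e2, Complex.exp_zero, one_smul]
    refine (A.le_opNorm y).trans ?_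
    gcongr with l
    rw [ContinuousMap.norm_le _ (by positivity)]
    intro t
    simp only [y, ContinuousMap.mul_apply, exp_apply_CK, ContinuousMap.smul_apply, smul_eq_mul,
        cof_apply, ContinuousMap.sub_apply, ContinuousMap.const_apply, norm_mul]
    by_cases hb : bmp s (r l) t = 0
    · simp [hb]; positivity
    have h1 := bmp_norm s (r l) t
    have h2 := (x l).norm_coe_le_norm t
    have h4 : ‖Complex.exp (z * (c l * ((w t - c0 : ℝ) : ℂ)))‖ ≤ Real.exp (‖z‖ * ((n + 1) * δ)) := by
      rw [Complex.norm_exp, Real.exp_le_exp]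
      refine (Complex.re_le_norm _).trans ?_
      rw [norm_mul, norm_mul, Complex.norm_real, Complex.norm_real]
      refine mul_le_mul_of_nonneg_left ?_ (norm_nonneg _)
      have h3 := abs_lt.mp (bmp_ne hb)
      have h5 : |s t - r i₀| ≤ n + 1 := by
        have h6 : (r l : ℝ) ≤ r i₀ + n := by exact_mod_cast hcase i₀ l
        have h7 : (r i₀ : ℝ) ≤ r l + n := by exact_mod_cast hcase l i₀
        rw [abs_le]; constructor <;> linarith
      have h8 : w t - c0 = (s t - r i₀) * δ := by rw [hs, hc0]; ring
      rw [h8, Real.norm_eq_abs, Real.norm_eq_abs, abs_mul, abs_of_pos hδ]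
      calc |c l| * (|s t - r i₀| * δ) ≤ 1 * (|s t - r i₀| * δ) := by
            gcongr; exact hc1 l
        _ ≤ _ := by rw [one_mul]; gcongr
    calc _ ≤ Real.exp (‖z‖ * ((n + 1) * δ)) * (1 * ‖x l‖) := by gcongr
      _ = _ := by ring

lemma transfer_const {n : ℕ} (i₀ : Fin n) {A : ContinuousMultilinearMap ℂ (fun _ : Fin n => C(K, ℂ)) ℂ}
    (hA : SplitVanish A) (w : C(K, ℝ)) (x : Fin n → C(K, ℂ)) (c : Fin n → ℝ)
    (hc : ∑ l, c l = 0) (hc1 : ∀ l, |c l| ≤ 1) (z z' : ℂ) :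
    A (fun l => NormedSpace.exp (z • (c l : ℂ) • cof w) * x l) =
    A (fun l => NormedSpace.exp (z' • (c l : ℂ) • cof w) * x l) := by
  have hn : (0:ℝ) < n := by exact_mod_cast i₀.pos
  refine pl_const (F := fun z : ℂ => A (fun l => NormedSpace.exp (z • (c l : ℂ) • cof w) * x l))
    (C := ‖A‖ * ∏ l, ‖x l‖) ?_ ?_ ?_ z z'
  · intro z
    have hg : ∀ l : Fin n, HasFDerivAt (fun z : ℂ => NormedSpace.exp (z • (c l : ℂ) • cof w) * x l)
      _ z := fun l => ((hasDerivAt_exp_smul_const ((c l : ℂ) • cof w) z).mul_const (x l)).hasFDerivAt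
    exact (HasFDerivAt.multilinear_comp A hg).differentiableAt
  · intro s
    refine (A.le_opNorm _).trans ?_
    gcongr with l
    rw [ContinuousMap.norm_le _ (by positivity)]
    intro t
    simp only [ContinuousMap.mul_apply, exp_apply_CK, ContinuousMap.smul_apply, smul_eq_mul,
        cof_apply, norm_mul]
    rw [Complex.norm_exp]
    simpa using (x l).norm_coe_le_norm t
  · intro ε hε
    set δ : ℝ := ε / (n * (n + 1)) with hδ
    have hδ0 : 0 < δ := by positivity
    obtain ⟨N, hN⟩ := exists_nat_ge (2 * ‖w‖ / δ)
    let s : C(K, ℝ) := ⟨fun t => (w t + ‖w‖) / δ, by fun_prop⟩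
    have hw : ∀ t, |w t| ≤ ‖w‖ := fun t => w.norm_coe_le_norm t
    have hsum := bmp_sum s N (fun t => by
        have := abs_le.mp (hw t)
        exact div_nonneg (by linarith) hδ0.le) (fun t => by
        have := abs_le.mp (hw t)
        refine le_trans ?_ hN
        simp only [s, ContinuousMap.coe_mk]
        gcongr; linarith)
    refine ⟨(Fintype.piFinset (fun _ : Fin n => Finset.range (N + 1))).card * (‖A‖ * ∏ l, ‖x l‖), ?_⟩
    intro z
    have e : A (fun l => NormedSpace.exp (z • (c l : ℂ) • cof w) * x l) =
        ∑ r ∈ Fintype.piFinset (fun _ : Fin n => Finset.range (N + 1)),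
          A (fun l => NormedSpace.exp (z • (c l : ℂ) • cof w) * (bmp s (r l) * x l)) := by
      have := A.toMultilinearMap.map_sum_finset
        (fun l (m : ℕ) => NormedSpace.exp (z • (c l : ℂ) • cof w) * (bmp s m * x l))
        (fun _ : Fin n => Finset.range (N + 1))
      rw [ContinuousMultilinearMap.coe_coe] at this
      rw [← this]
      congr 1
      ext1 l
      rw [← Finset.mul_sum, ← Finset.sum_mul, hsum, one_mul]
    beta_reduce
    rw [e]
    refine (norm_sum_le _ _).trans ?_
    refine (Finset.sum_le_card_nsmul _ _ _ (fun r _ => term_bound i₀ hA w s x c hc hc1 δ ‖w‖ hδ0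
      (fun t => by simp only [s, ContinuousMap.coe_mk]; field_simp; ring) r z)).trans (le_of_eq ?_)
    rw [nsmul_eq_mul, Finset.prod_mul_distrib, Finset.prod_const, ← Real.exp_nat_mul]
    have : ((Finset.univ : Finset (Fin n)).card : ℝ) * (‖z‖ * ((n + 1) * δ)) = ε * ‖z‖ := by
      rw [hδ, Finset.card_univ, Fintype.card_fin]; field_simp
    rw [this]; ring

lemma transfer_real {n : ℕ} {A : ContinuousMultilinearMap ℂ (fun _ : Fin n => C(K, ℂ)) ℂ}
    (hA : SplitVanish A) (w : C(K, ℝ)) (x : Fin n → C(K, ℂ)) {i j : Fin n} (hij : i ≠ j) :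
    A (Function.update x i (cof w * x i)) = A (Function.update x j (cof w * x j)) := by
  let c : Fin n → ℝ := fun l => (if l = i then 1 else 0) - (if l = j then 1 else 0)
  have hc : ∑ l, c l = 0 := by simp [c, Finset.sum_sub_distrib]
  have hc1 : ∀ l, |c l| ≤ 1 := by
    intro l
    simp only [c]
    split_ifs <;> simp
  have hg : ∀ l : Fin n, HasFDerivAt (fun z : ℂ => NormedSpace.exp (z • (c l : ℂ) • cof w) * x l)
      _ 0 := fun l => ((hasDerivAt_exp_smul_const ((c l : ℂ) • cof w) 0).mul_const (x l)).hasFDerivAt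
  have h1 := (HasFDerivAt.multilinear_comp A hg).hasDerivAt
  have h2 : (fun z : ℂ => A (fun l => NormedSpace.exp (z • (c l : ℂ) • cof w) * x l)) =
      fun _ => A (fun l => NormedSpace.exp ((0:ℂ) • (c l : ℂ) • cof w) * x l) := by
    ext z
    exact transfer_const i hA w x c hc hc1 z 0
  rw [h2] at h1
  have h3 := h1.unique (hasDerivAt_const _ _)
  simp only [zero_smul, NormedSpace.exp_zero, one_mul, sum_apply,
    ContinuousLinearMap.comp_apply, ContinuousLinearMap.toSpanSingleton_apply, one_smul,
    ContinuousMultilinearMap.toContinuousLinearMap_apply, smul_mul_assoc,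
    ContinuousMultilinearMap.map_update_smul] at h3
  simp only [c, Complex.ofReal_sub, sub_smul, Finset.sum_sub_distrib] at h3
  simp only [apply_ite Complex.ofReal, Complex.ofReal_one, Complex.ofReal_zero, ite_smul, one_smul,
    zero_smul, Finset.sum_ite_eq', Finset.mem_univ, if_true] at h3
  exact sub_eq_zero.mp h3

lemma transfer {n : ℕ} {A : ContinuousMultilinearMap ℂ (fun _ : Fin n => C(K, ℂ)) ℂ}
    (hA : SplitVanish A) (w : C(K, ℂ)) (x : Fin n → C(K, ℂ)) {i j : Fin n} (hij : i ≠ j) :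
    A (Function.update x i (w * x i)) = A (Function.update x j (w * x j)) := by
  have e : w = cof ⟨fun t => (w t).re, by fun_prop⟩ +
      Complex.I • cof ⟨fun t => (w t).im, by fun_prop⟩ := by
    ext t
    simp [mul_comm Complex.I, Complex.re_add_im]
  rw [e]
  simp only [add_mul, smul_mul_assoc, ContinuousMultilinearMap.map_update_add,
    ContinuousMultilinearMap.map_update_smul]
  rw [transfer_real hA _ x hij, transfer_real hA _ x hij]

lemma collapse {n : ℕ} {A : ContinuousMultilinearMap ℂ (fun _ : Fin n => C(K, ℂ)) ℂ}
    (hA : SplitVanish A) (i : Fin n) (x : C(K, ℂ)) :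
    A (fun _ => x) = A (Function.update (fun _ => 1) i (x ^ n)) := by
  have key : ∀ s : Finset (Fin n), i ∉ s →
      A (fun _ => x) = A (Function.update (fun l => if l ∈ s then 1 else x) i (x ^ (s.card + 1))) := by
    intro s
    induction s using Finset.induction_on with
    | empty =>
      intro _
      simp
    | insert a s ha ih =>
      intro hi
      simp only [Finset.mem_insert, not_or] at hi
      rw [ih hi.2, Finset.card_insert_of_notMem ha]
      have := transfer hA x (Function.update (fun l => if l ∈ insert a s then 1 else x) i
        (x ^ (s.card + 1))) (Ne.symm hi.1)
      rw [Function.update_self, Function.update_idem,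
        Function.update_of_ne (Ne.symm hi.1)] at this
      simp only [Finset.mem_insert, true_or, if_true, mul_one] at this
      have e2 : x ^ (s.card + 1 + 1) = x * x ^ (s.card + 1) := by ring
      simp only [Finset.mem_insert]
      rw [e2]
      refine Eq.trans ?_ this
      · congr 1
        ext1 l
        by_cases hl : l = a
        · subst hl
          rw [Function.update_of_ne (Ne.symm hi.1), Function.update_self]
          simp [ha]
        · rw [Function.update_of_ne hl]
          by_cases hli : l = i
          · subst hli; simp
          · simp [Function.update_of_ne hli, hl]
  rw [key (Finset.univ.erase i) (by simp)]
  have h1 : (Finset.univ.erase i).card + 1 = n := by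
    rw [Finset.card_erase_of_mem (Finset.mem_univ _), Finset.card_univ, Fintype.card_fin]
    have := i.pos
    omega
  rw [h1]
  congr 1
  ext1 l
  by_cases hl : l = i
  · subst hl; simp
  · simp [Function.update_of_ne hl, hl]

end Transfer


section Riesz
set_option linter.unusedSectionVars false
variable {K : Type*} [TopologicalSpace K] [CompactSpace K]

/-- order interval image -/
def ordImg (ψ : C(K, ℝ) →L[ℝ] ℝ) (g : C(K, ℝ)) : Set ℝ := ψ '' {v | 0 ≤ v ∧ v ≤ g}

/-- positive part of a functional, on the positive cone -/
noncomputable def posP (ψ : C(K, ℝ) →L[ℝ] ℝ) (g : C(K, ℝ)) : ℝ := sSup (ordImg ψ g)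

lemma norm_le_of_Icc {g v : C(K, ℝ)} (h0 : 0 ≤ v) (h : v ≤ g) : ‖v‖ ≤ ‖g‖ := by
  rw [ContinuousMap.norm_le _ (norm_nonneg _)]
  intro t
  have h1 : 0 ≤ v t := h0 t
  have h2 : v t ≤ g t := h t
  rw [Real.norm_of_nonneg h1]
  exact h2.trans ((le_abs_self _).trans (g.norm_coe_le_norm t))

lemma ordImg_le (ψ : C(K, ℝ) →L[ℝ] ℝ) (g : C(K, ℝ)) : ∀ y ∈ ordImg ψ g, y ≤ ‖ψ‖ * ‖g‖ := by
  rintro _ ⟨v, ⟨h0, h1⟩, rfl⟩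
  refine (le_abs_self _).trans ((ψ.le_opNorm v).trans ?_)
  gcongr
  exact norm_le_of_Icc h0 h1

lemma posP_isLUB (ψ : C(K, ℝ) →L[ℝ] ℝ) {g : C(K, ℝ)} (hg : 0 ≤ g) : IsLUB (ordImg ψ g) (posP ψ g) :=
  isLUB_csSup ⟨_, 0, ⟨le_rfl, hg⟩, rfl⟩ ⟨_, ordImg_le ψ g⟩

lemma posP_nonneg (ψ : C(K, ℝ) →L[ℝ] ℝ) {g : C(K, ℝ)} (hg : 0 ≤ g) : 0 ≤ posP ψ g :=
  (posP_isLUB ψ hg).1 ⟨0, ⟨le_rfl, hg⟩, map_zero ψ⟩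

lemma posP_le (ψ : C(K, ℝ) →L[ℝ] ℝ) {g : C(K, ℝ)} (hg : 0 ≤ g) : posP ψ g ≤ ‖ψ‖ * ‖g‖ :=
  (posP_isLUB ψ hg).2 (ordImg_le ψ g)

open Pointwise in
lemma posP_add (ψ : C(K, ℝ) →L[ℝ] ℝ) {g₁ g₂ : C(K, ℝ)} (h₁ : 0 ≤ g₁) (h₂ : 0 ≤ g₂) :
    posP ψ (g₁ + g₂) = posP ψ g₁ + posP ψ g₂ := by
  have h := (posP_isLUB ψ h₁).add (posP_isLUB ψ h₂)
  refine (posP_isLUB ψ (add_nonneg h₁ h₂)).unique ?_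
  convert h using 1
  ext y
  rw [Set.mem_add]
  constructor
  · rintro ⟨v, ⟨hv0, hv⟩, rfl⟩
    refine ⟨_, ⟨v ⊓ g₁, ⟨le_inf hv0 h₁, inf_le_right⟩, rfl⟩, _, ⟨v - v ⊓ g₁, ⟨?_, ?_⟩, rfl⟩, ?_⟩
    · exact sub_nonneg.mpr inf_le_left
    · intro t
      have h3 : v t ≤ g₁ t + g₂ t := hv t
      have h4 : 0 ≤ g₂ t := h₂ t
      show v t - min (v t) (g₁ t) ≤ g₂ t
      rcases min_cases (v t) (g₁ t) with h | h <;> linarith [h.1]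
    · rw [← map_add]; congr 1; abel
  · rintro ⟨_, ⟨v, ⟨hv0, hv⟩, rfl⟩, _, ⟨u, ⟨hu0, hu⟩, rfl⟩, rfl⟩
    exact ⟨v + u, ⟨add_nonneg hv0 hu0, add_le_add hv hu⟩, map_add _ _ _⟩

lemma posP_smul_le (ψ : C(K, ℝ) →L[ℝ] ℝ) {g : C(K, ℝ)} (h : 0 ≤ g) {c : ℝ} (hc : 0 < c) :
    c * posP ψ g ≤ posP ψ (c • g) := by
  have h1 : 0 ≤ c • g := smul_nonneg hc.le h
  rw [mul_comm, ← le_div_iff₀ hc]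
  refine (posP_isLUB ψ h).2 ?_
  rintro _ ⟨v, ⟨hv0, hv⟩, rfl⟩
  rw [le_div_iff₀ hc]
  refine (posP_isLUB ψ h1).1 ⟨c • v, ⟨smul_nonneg hc.le hv0, smul_le_smul_of_nonneg_left hv hc.le⟩, ?_⟩
  simp [mul_comm]

lemma posP_smul (ψ : C(K, ℝ) →L[ℝ] ℝ) {g : C(K, ℝ)} (h : 0 ≤ g) {c : ℝ} (hc : 0 ≤ c) :
    posP ψ (c • g) = c * posP ψ g := by
  rcases hc.eq_or_lt with rfl | hc
  · have h1 := posP_le ψ (le_refl (0 : C(K, ℝ)))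
    have h2 := posP_nonneg ψ (le_refl (0 : C(K, ℝ)))
    simp only [zero_smul, zero_mul]
    simp at h1
    linarith
  · refine le_antisymm ?_ (posP_smul_le ψ h hc)
    have := posP_smul_le ψ (smul_nonneg hc.le h) (inv_pos.mpr hc)
    rw [inv_smul_smul₀ hc.ne', inv_mul_le_iff₀ hc] at this
    exact this

open Pointwise in
lemma posP_neg (ψ : C(K, ℝ) →L[ℝ] ℝ) {g : C(K, ℝ)} (h : 0 ≤ g) :
    posP ψ g = ψ g + posP (-ψ) g := by
  have h1 := (isLUB_singleton (a := ψ g)).add (posP_isLUB (-ψ) h)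
  refine (posP_isLUB ψ h).unique ?_
  convert h1 using 1
  ext y
  rw [Set.mem_add]
  constructor
  · rintro ⟨v, ⟨hv0, hv⟩, rfl⟩
    exact ⟨_, rfl, _, ⟨g - v, ⟨sub_nonneg.mpr hv, sub_le_self _ hv0⟩, rfl⟩, by simp⟩
  · rintro ⟨_, rfl, _, ⟨v, ⟨hv0, hv⟩, rfl⟩, rfl⟩
    exact ⟨g - v, ⟨sub_nonneg.mpr hv, sub_le_self _ hv0⟩, by simp [sub_eq_add_neg]⟩

variable [T2Space K] [MeasurableSpace K] [BorelSpace K]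

lemma integrable_CK {X : Type*} [NormedAddCommGroup X] [SecondCountableTopology X]
    (h : C(K, X)) (μ : Measure K) [IsFiniteMeasure μ] :
    Integrable (fun t => h t) μ :=
  h.continuous.integrable_of_hasCompactSupport (HasCompactSupport.of_compactSpace _)

/-- coercion -/
noncomputable def toR (u : CompactlySupportedContinuousMap K NNReal) : C(K, ℝ) :=
  ⟨fun t => (u t : ℝ), by fun_prop⟩

lemma toR_nonneg (u : CompactlySupportedContinuousMap K NNReal) : 0 ≤ toR u :=
  fun t => (u t).coe_nonneg

lemma riesz_pos (ψ : C(K, ℝ) →L[ℝ] ℝ) : ∃ ν : Measure K, IsFiniteMeasure ν ∧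
    ν.real Set.univ ≤ ‖ψ‖ ∧ ∀ g : C(K, ℝ), 0 ≤ g → ∫ t, g t ∂ν = posP ψ g := by
  let Λ : CompactlySupportedContinuousMap K NNReal →ₗ[NNReal] NNReal :=
    { toFun := fun u => (posP ψ (toR u)).toNNReal
      map_add' := fun u v => by
        have : toR (u + v) = toR u + toR v := by ext t; simp [toR]
        rw [this, posP_add ψ (toR_nonneg u) (toR_nonneg v), Real.toNNReal_add
          (posP_nonneg ψ (toR_nonneg u)) (posP_nonneg ψ (toR_nonneg v))]
      map_smul' := fun c u => by
        have : toR (c • u) = (c : ℝ) • toR u := by ext t; simp [toR]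
        rw [this, posP_smul ψ (toR_nonneg u) c.coe_nonneg, Real.toNNReal_mul c.coe_nonneg,
          Real.toNNReal_coe, RingHom.id_apply, smul_eq_mul] }
  have hint : ∀ g : C(K, ℝ), 0 ≤ g → ∫ t, g t ∂(NNRealRMK.rieszMeasure Λ) = posP ψ g := by
    intro g hg
    let u : CompactlySupportedContinuousMap K NNReal :=
      ⟨⟨fun t => (g t).toNNReal, by fun_prop⟩, HasCompactSupport.of_compactSpace _⟩
    have e : toR u = g := by
      ext t
      exact Real.coe_toNNReal _ (hg t)
    have := NNRealRMK.integral_rieszMeasure Λ u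
    have e2 : ((Λ u : NNReal) : ℝ) = posP ψ (toR u) :=
      Real.coe_toNNReal _ (posP_nonneg ψ (toR_nonneg u))
    rw [e2, e] at this
    rw [← this]
    congr 1
    ext t
    exact (Real.coe_toNNReal _ (hg t)).symm
  have hfin : IsFiniteMeasure (NNRealRMK.rieszMeasure Λ) := by
    let u : CompactlySupportedContinuousMap K NNReal :=
      ⟨⟨fun t => 1, by fun_prop⟩, HasCompactSupport.of_compactSpace _⟩
    have := NNRealRMK.lintegral_rieszMeasure Λ u
    have h2 : ∫⁻ t, (u t : ENNReal) ∂(NNRealRMK.rieszMeasure Λ) =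
      NNRealRMK.rieszMeasure Λ Set.univ := by simp [u]
    exact ⟨by rw [← h2, this]; exact ENNReal.coe_lt_top⟩
  refine ⟨_, hfin, ?_, hint⟩
  have h1 := hint 1 zero_le_one
  simp only [ContinuousMap.one_apply, integral_const, smul_eq_mul, mul_one] at h1
  rw [h1]
  refine (posP_le ψ zero_le_one).trans ?_
  have : ‖(1 : C(K, ℝ))‖ ≤ 1 := by
    rw [ContinuousMap.norm_le _ zero_le_one]; intro t; simp
  nlinarith [norm_nonneg ψ]

lemma riesz_real (ψ : C(K, ℝ) →L[ℝ] ℝ) : ∃ ν₁ ν₂ : Measure K, IsFiniteMeasure ν₁ ∧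
    IsFiniteMeasure ν₂ ∧ ν₁.real Set.univ ≤ ‖ψ‖ ∧ ν₂.real Set.univ ≤ ‖ψ‖ ∧
    ∀ g : C(K, ℝ), ψ g = ∫ t, g t ∂ν₁ - ∫ t, g t ∂ν₂ := by
  obtain ⟨ν₁, hf₁, hn₁, h₁⟩ := riesz_pos ψ
  obtain ⟨ν₂, hf₂, hn₂, h₂⟩ := riesz_pos (-ψ)
  have hn₂ : ν₂.real Set.univ ≤ ‖ψ‖ := hn₂.trans
    (ContinuousLinearMap.opNorm_le_bound _ (ContinuousLinearMap.opNorm_nonneg ψ) (fun v => by simpa using ψ.le_opNorm v))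
  refine ⟨ν₁, ν₂, hf₁, hf₂, hn₁, hn₂, fun g => ?_⟩
  have hp : ∀ g : C(K, ℝ), 0 ≤ g → ψ g = ∫ t, g t ∂ν₁ - ∫ t, g t ∂ν₂ := by
    intro g hg
    rw [h₁ g hg, h₂ g hg, posP_neg ψ hg]; ring
  have e : g = g ⊔ 0 - (g ⊔ 0 - g) := by abel
  have p1 : 0 ≤ g ⊔ 0 := le_sup_right
  have p2 : 0 ≤ g ⊔ 0 - g := sub_nonneg.mpr le_sup_left
  have i : ∀ (u v : C(K, ℝ)) (ν : Measure K) [IsFiniteMeasure ν],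
      ∫ t, (u - v) t ∂ν = ∫ t, u t ∂ν - ∫ t, v t ∂ν := fun u v ν _ =>
    integral_sub (integrable_CK u ν) (integrable_CK v ν)
  rw [e, map_sub, hp _ p1, hp _ p2, i _ _ ν₁, i _ _ ν₂]
  ring

/-- the four unit coefficients -/
noncomputable def sgm : Fin 4 → ℂ := ![1, -1, Complex.I, -Complex.I]

lemma norm_sgm (j : Fin 4) : ‖sgm j‖ = 1 := by
  fin_cases j <;> simp [sgm]

lemma norm_cof_le (w : C(K, ℝ)) : ‖cof w‖ ≤ ‖w‖ := by
  rw [ContinuousMap.norm_le _ (norm_nonneg _)]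
  intro t
  simpa using w.norm_coe_le_norm t

lemma riesz_complex (ψ : C(K, ℂ) →L[ℂ] ℂ) : ∃ ν : Fin 4 → Measure K,
    (∀ j, IsFiniteMeasure (ν j)) ∧ (∀ j, (ν j).real Set.univ ≤ ‖ψ‖) ∧
    ∀ h : C(K, ℂ), ψ h = ∑ j, sgm j * ∫ t, h t ∂(ν j) := by
  have hadd : ∀ u v : C(K, ℝ), cof (u + v) = cof u + cof v := fun u v => by ext t; simp
  have hsm : ∀ (c : ℝ) (v : C(K, ℝ)), cof (c • v) = (c : ℂ) • cof v := fun u v => by ext t; simp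
  let a : C(K, ℝ) →L[ℝ] ℝ := LinearMap.mkContinuous
    { toFun := fun w => (ψ (cof w)).re
      map_add' := fun u v => by rw [hadd, map_add, Complex.add_re]
      map_smul' := fun c v => by rw [hsm, map_smul]; simp } ‖ψ‖ (fun w =>
        (Complex.abs_re_le_norm _).trans ((ψ.le_opNorm _).trans (by gcongr; exact norm_cof_le w)))
  let b : C(K, ℝ) →L[ℝ] ℝ := LinearMap.mkContinuous
    { toFun := fun w => (ψ (cof w)).im
      map_add' := fun u v => by rw [hadd, map_add, Complex.add_im]
      map_smul' := fun c v => by rw [hsm, map_smul]; simp } ‖ψ‖ (fun w =>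
        (Complex.abs_im_le_norm _).trans ((ψ.le_opNorm _).trans (by gcongr; exact norm_cof_le w)))
  have ha : ‖a‖ ≤ ‖ψ‖ := LinearMap.mkContinuous_norm_le _ (norm_nonneg _) _
  have hb : ‖b‖ ≤ ‖ψ‖ := LinearMap.mkContinuous_norm_le _ (norm_nonneg _) _
  obtain ⟨ν₁, ν₂, f₁, f₂, n₁, n₂, h₁⟩ := riesz_real a
  obtain ⟨ν₃, ν₄, f₃, f₄, n₃, n₄, h₂⟩ := riesz_real b
  refine ⟨![ν₁, ν₂, ν₃, ν₄], ?_, ?_, ?_⟩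
  · intro j; fin_cases j <;> assumption
  · intro j; fin_cases j
    · exact n₁.trans ha
    · exact n₂.trans ha
    · exact n₃.trans hb
    · exact n₄.trans hb
  · have hr : ∀ w : C(K, ℝ), ψ (cof w) = (∫ t, cof w t ∂ν₁ - ∫ t, cof w t ∂ν₂) +
        Complex.I * (∫ t, cof w t ∂ν₃ - ∫ t, cof w t ∂ν₄) := by
      intro w
      have e1 : (ψ (cof w)).re = _ := h₁ w
      have e2 : (ψ (cof w)).im = _ := h₂ w
      rw [← Complex.re_add_im (ψ (cof w)), e1, e2]
      simp only [cof_apply, integral_complex_ofReal]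
      push_cast; ring
    intro h
    have e : h = cof ⟨fun t => (h t).re, by fun_prop⟩ +
        Complex.I • cof ⟨fun t => (h t).im, by fun_prop⟩ := by
      ext t
      simp [mul_comm Complex.I, Complex.re_add_im]
    have i : ∀ (u v : C(K, ℂ)) (ν : Measure K) [IsFiniteMeasure ν],
      ∫ t, (u + Complex.I • v) t ∂ν = ∫ t, u t ∂ν + Complex.I * ∫ t, v t ∂ν := fun u v ν _ => by
      rw [← integral_const_mul]
      exact integral_add (integrable_CK u ν) ((integrable_CK v ν).const_mul _)
    rw [e, map_add, map_smul, hr, hr, Fin.sum_univ_four]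
    simp only [sgm, Matrix.cons_val]
    rw [i _ _ ν₁, i _ _ ν₂, i _ _ ν₃, i _ _ ν₄, smul_eq_mul]
    ring

end Riesz

section Fin5
set_option linter.unusedSectionVars false
variable {K : Type*} [TopologicalSpace K] [CompactSpace K]

/-- the functional attached to the homogeneous Taylor term of degree `n + 1` -/
noncomputable def Phi (f : C(K, ℂ) → ℂ) (n : ℕ) : C(K, ℂ) →L[ℂ] ℂ :=
  ((n + 1).factorial : ℂ)⁻¹ • (iteratedFDeriv ℂ (n + 1) f 0).toContinuousLinearMap (fun _ => 1) 0

lemma Phi_pow {f : C(K, ℂ) → ℂ} (hf : HB f) (ho : IsOrthAdd f) (n : ℕ) (x : C(K, ℂ)) :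
    Phi f n (x ^ (n + 1)) = ((n + 1).factorial : ℂ)⁻¹ *
      iteratedDeriv (n + 1) (fun z : ℂ => f (z • x)) 0 := by
  have h1 := collapse (splitVanish_iteratedFDeriv hf ho (n + 1)) 0 x
  have h2 := ContinuousLinearMap.iteratedFDeriv_comp_right
    ((1 : ℂ →L[ℂ] ℂ).smulRight x) (hf.contDiff (n + 1)) 0 (i := n + 1) le_rfl
  have h3 : iteratedDeriv (n + 1) (fun z : ℂ => f (z • x)) 0 =
      iteratedFDeriv ℂ (n + 1) f 0 (fun _ => x) := by
    rw [iteratedDeriv_eq_iteratedFDeriv]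
    have : (fun z : ℂ => f (z • x)) = f ∘ ((1 : ℂ →L[ℂ] ℂ).smulRight x) := by
      ext z; simp
    rw [this, h2]
    simp
  rw [h3, h1]
  simp [Phi]

lemma Phi_hasSum {f : C(K, ℂ) → ℂ} (hf : HB f) (ho : IsOrthAdd f) (x : C(K, ℂ)) :
    HasSum (fun n => Phi f n (x ^ (n + 1))) (f x) := by
  have f0 : f 0 = 0 := by
    have := ho 0 0 (by simp)
    simpa using this
  have hd : Differentiable ℂ (fun z : ℂ => f (z • x)) :=
    hf.1.comp (differentiable_id.smul_const x)
  have h := Complex.hasSum_taylorSeries_of_entire hd 0 1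
  have h' := (hasSum_nat_add_iff' 1).mpr h
  simp only [Finset.range_one, Finset.sum_singleton, iteratedDeriv_zero, zero_smul, one_smul, f0,
    sub_zero, one_pow, smul_eq_mul, mul_zero, one_mul] at h'
  simp only [Phi_pow hf ho]
  exact h'

lemma Phi_bound {f : C(K, ℂ) → ℂ} (hf : HB f) (ho : IsOrthAdd f) (R : ℝ) (hR : 0 < R) :
    ∃ C : ℝ, ∀ n, ‖Phi f n‖ ≤ C / R ^ (n + 1) := by
  obtain ⟨C, hC⟩ := hf.2 R hR
  have hC0 : 0 ≤ C := (norm_nonneg _).trans (hC 0 (by simpa using hR.le))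
  refine ⟨4 * C, fun n => ?_⟩
  have A : ∀ x : C(K, ℂ), ‖x‖ ≤ 1 → ‖Phi f n (x ^ (n + 1))‖ ≤ C / R ^ (n + 1) := by
    intro x hx
    have hd : Differentiable ℂ (fun z : ℂ => f (z • x)) :=
      hf.1.comp (differentiable_id.smul_const x)
    have := Complex.norm_iteratedDeriv_le_of_forall_mem_sphere_norm_le (n + 1) hR
      (hd.diffContOnCl (s := Metric.ball 0 R)) (C := C) (fun z hz => hC _ (by
        rw [norm_smul, mem_sphere_zero_iff_norm.mp hz]
        nlinarith))
    rw [Phi_pow hf ho, norm_mul, norm_inv, Complex.norm_natCast,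
      inv_mul_le_iff₀ (by positivity)]
    rwa [mul_div_assoc] at this
  have B : ∀ p : C(K, ℝ), 0 ≤ p → ‖p‖ ≤ 1 → ‖Phi f n (cof p)‖ ≤ C / R ^ (n + 1) := by
    intro p hp hp1
    let q : C(K, ℝ) := ⟨fun t => (p t) ^ (((n + 1 : ℕ) : ℝ)⁻¹),
      p.continuous.rpow_const (fun t => Or.inr (by positivity))⟩
    have hq : cof q ^ (n + 1) = cof p := by
      ext t
      rw [ContinuousMap.pow_apply, cof_apply, cof_apply, ← Complex.ofReal_pow]
      congr 1
      exact Real.rpow_inv_natCast_pow (hp t) (by omega)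
    rw [← hq]
    apply A
    rw [ContinuousMap.norm_le _ zero_le_one]
    intro t
    have h0 : 0 ≤ p t := hp t
    have h1 : p t ≤ 1 := (le_abs_self _).trans ((p.norm_coe_le_norm t).trans hp1)
    rw [cof_apply, Complex.norm_real]
    change ‖(p t) ^ (((n + 1 : ℕ) : ℝ)⁻¹)‖ ≤ 1
    rw [Real.norm_of_nonneg (Real.rpow_nonneg h0 _)]
    exact Real.rpow_le_one h0 h1 (by positivity)
  refine ContinuousLinearMap.opNorm_le_of_unit_norm (by positivity) (fun h hh => ?_)
  have hre : ∀ t, |(h t).re| ≤ 1 := fun t =>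
    (Complex.abs_re_le_norm _).trans ((h.norm_coe_le_norm t).trans hh.le)
  have him : ∀ t, |(h t).im| ≤ 1 := fun t =>
    (Complex.abs_im_le_norm _).trans ((h.norm_coe_le_norm t).trans hh.le)
  have D : ∀ u : K → ℝ, Continuous u → (∀ t, |u t| ≤ 1) → ∃ v : C(K, ℝ),
      (∀ t, v t = max (u t) 0) ∧ ‖Phi f n (cof v)‖ ≤ C / R ^ (n + 1) := by
    intro u hu h1
    refine ⟨⟨fun t => max (u t) 0, by fun_prop⟩, fun t => rfl, B _ (fun t => le_max_right _ _) ?_⟩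
    rw [ContinuousMap.norm_le _ zero_le_one]
    intro t
    simp only [ContinuousMap.coe_mk]
    rw [Real.norm_of_nonneg (le_max_right _ _)]
    exact max_le ((le_abs_self _).trans (h1 t)) zero_le_one
  obtain ⟨a, ha, ba⟩ := D (fun t => (h t).re) (by fun_prop) hre
  obtain ⟨b, hb, bb⟩ := D (fun t => -(h t).re) (by fun_prop) (by simpa using hre)
  obtain ⟨c, hc, bc⟩ := D (fun t => (h t).im) (by fun_prop) him
  obtain ⟨d, hd, bd⟩ := D (fun t => -(h t).im) (by fun_prop) (by simpa using him)
  have mm : ∀ s : ℝ, max s 0 - max (-s) 0 = s := fun s => by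
    rcases le_total s 0 with hs | hs
    · rw [max_eq_right hs, max_eq_left (by linarith)]; ring
    · rw [max_eq_left hs, max_eq_right (by linarith)]; ring
  have e : h = (cof a - cof b) + Complex.I • (cof c - cof d) := by
    ext t
    apply Complex.ext <;> simp [ha, hb, hc, hd, mm]
  rw [e, map_add, map_smul, map_sub, map_sub]
  have n1 := norm_add_le (Phi f n (cof a) - Phi f n (cof b))
    (Complex.I • (Phi f n (cof c) - Phi f n (cof d)))
  have n2 := norm_sub_le (Phi f n (cof a)) (Phi f n (cof b))
  have n3 := norm_sub_le (Phi f n (cof c)) (Phi f n (cof d))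
  rw [norm_smul, Complex.norm_I, one_mul] at n1
  rw [mul_div_assoc]
  linarith

lemma Phi_summable {f : C(K, ℂ) → ℂ} (hf : HB f) (ho : IsOrthAdd f) (r : ℝ) (hr : 0 < r) :
    Summable (fun n => ‖Phi f n‖ * r ^ (n + 1)) := by
  obtain ⟨C, hC⟩ := Phi_bound hf ho (2 * r) (by positivity)
  refine Summable.of_nonneg_of_le (fun n => by positivity) (fun n => ?_)
    ((summable_geometric_two.mul_left (C / 2)))
  calc ‖Phi f n‖ * r ^ (n + 1) ≤ C / (2 * r) ^ (n + 1) * r ^ (n + 1) := by gcongr; exact hC n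
    _ = C / 2 * (1 / 2) ^ n := by
      rw [mul_pow, pow_succ 2 n, one_div, inv_pow]; field_simp

variable [T2Space K] [MeasurableSpace K] [BorelSpace K]

lemma integrable_mul_pow {μ : Measure K} {g : K → ℂ} (hg : Integrable g μ) (x : C(K, ℂ)) (k : ℕ) :
    Integrable (fun t => g t * x t ^ k) μ := by
  have h := hg.bdd_mul (c := ‖x‖ ^ k) (f := fun t => x t ^ k)
    ((x.continuous.pow k).aestronglyMeasurable)
    (Eventually.of_forall (fun t => by
      rw [norm_pow]; exact pow_le_pow_left₀ (norm_nonneg _) (x.norm_coe_le_norm t) k))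
  simpa only [mul_comm] using h

lemma repr_of_orthAdd {f : C(K, ℂ) → ℂ} (hf : HB f) (ho : IsOrthAdd f) :
    ∃ (μ : Measure K) (g : ℕ → K → ℂ),
        IsFiniteMeasure μ ∧
        (∀ k, Integrable (g (k + 1)) μ) ∧
        (∀ k, ∫ t, ‖g (k + 1) t‖ ∂μ ≤ 4 * ‖Phi f k‖) ∧
        (∀ k, ∀ x : C(K, ℂ), ∫ t, g (k + 1) t * x t ^ (k + 1) ∂μ = Phi f k (x ^ (k + 1))) := by
  choose ν hfin hn hν using fun n => riesz_complex (Phi f n)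
  let μ : Measure K := Measure.sum (fun p : ℕ × Fin 4 => ν p.1 p.2)
  have hac : ∀ n j, ν n j ≪ μ := fun n j =>
    (Measure.le_sum (fun p : ℕ × Fin 4 => ν p.1 p.2) (n, j)).absolutelyContinuous
  have hμ : IsFiniteMeasure μ := by
    refine ⟨?_⟩
    rw [Measure.sum_apply _ MeasurableSet.univ, ENNReal.tsum_prod']
    have hs : Summable (fun n => 4 * ‖Phi f n‖) := by
      have := (Phi_summable hf ho 1 one_pos).mul_left 4
      simpa using this
    refine lt_of_le_of_lt (ENNReal.tsum_le_tsum
      (g := fun n => ENNReal.ofReal (4 * ‖Phi f n‖)) (fun n => ?_)) hs.tsum_ofReal_lt_top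
    rw [tsum_fintype]
    calc ∑ j, ν n j Set.univ ≤ ∑ j : Fin 4, ENNReal.ofReal ‖Phi f n‖ := by
          refine Finset.sum_le_sum (fun j _ => ?_)
          have := hfin n j
          rw [← ofReal_measureReal]
          exact ENNReal.ofReal_le_ofReal (hn n j)
      _ = ENNReal.ofReal (4 * ‖Phi f n‖) := by
          rw [← ENNReal.ofReal_sum_of_nonneg (fun _ _ => ContinuousLinearMap.opNorm_nonneg _)]
          simp
  have hi : ∀ n j, Integrable (fun t => sgm j * (((ν n j).rnDeriv μ t).toReal : ℂ)) μ := by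
    intro n j
    have := hfin n j
    exact (Measure.integrable_toReal_rnDeriv (μ := ν n j) (ν := μ)).ofReal.const_mul _
  refine ⟨μ, fun k t => ∑ j, sgm j * (((ν (k - 1) j).rnDeriv μ t).toReal : ℂ), hμ, ?_, ?_, ?_⟩
  · intro k
    simp only [Nat.add_sub_cancel]
    exact integrable_finsetSum _ (fun j _ => hi k j)
  · intro k
    simp only [Nat.add_sub_cancel]
    calc ∫ t, ‖∑ j, sgm j * (((ν k j).rnDeriv μ t).toReal : ℂ)‖ ∂μ
        ≤ ∫ t, ∑ j, ((ν k j).rnDeriv μ t).toReal ∂μ := by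
          refine integral_mono ((integrable_finsetSum _ (fun j _ => hi k j)).norm)
            (integrable_finsetSum _ (fun j _ => ?_)) (fun t => ?_)
          · have := hfin k j
            exact Measure.integrable_toReal_rnDeriv
          · refine (norm_sum_le _ _).trans (Finset.sum_le_sum (fun j _ => ?_))
            rw [norm_mul, norm_sgm, one_mul, Complex.norm_real,
              Real.norm_of_nonneg ENNReal.toReal_nonneg]
      _ = ∑ j, (ν k j).real Set.univ := by
          rw [integral_finsetSum _ (fun j _ => ?_)]
          · refine Finset.sum_congr rfl (fun j _ => ?_)
            have := hfin k j
            exact Measure.integral_toReal_rnDeriv (hac k j)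
          · have := hfin k j
            exact Measure.integrable_toReal_rnDeriv
      _ ≤ ∑ j : Fin 4, ‖Phi f k‖ := Finset.sum_le_sum (fun j _ => hn k j)
      _ = 4 * ‖Phi f k‖ := by simp
  · intro k x
    simp only [Nat.add_sub_cancel, Finset.sum_mul]
    rw [integral_finsetSum _ (fun j _ => integrable_mul_pow (hi k j) x (k + 1)), hν k]
    refine Finset.sum_congr rfl (fun j _ => ?_)
    have := hfin k j
    simp only [mul_assoc]
    rw [integral_const_mul, ← integral_rnDeriv_smul (hac k j)]
    simp

lemma orthAdd_of_repr {f : C(K, ℂ) → ℂ} {μ : Measure K} {g : ℕ → K → ℂ}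
    (hg : ∀ k, Integrable (g (k + 1)) μ)
    (hs : ∀ x : C(K, ℂ),
      Summable (fun k : ℕ => ∫ t, ‖g (k + 1) t * (x t) ^ (k + 1)‖ ∂μ))
    (hr : ∀ x : C(K, ℂ), f x = ∫ t, (∑' k : ℕ, g (k + 1) t * (x t) ^ (k + 1)) ∂μ) :
    IsOrthAdd f := by
  have H : ∀ x, HasSum (fun k : ℕ => ∫ t, g (k + 1) t * (x t) ^ (k + 1) ∂μ) (f x) := fun x => by
    rw [hr x]
    exact hasSum_integral_of_summable_integral_norm
      (fun k => integrable_mul_pow (hg k) x (k + 1)) (hs x)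
  intro x y hxy
  refine (H (x + y)).unique ?_
  convert (H x).add (H y) using 2 with k
  rw [← integral_add (integrable_mul_pow (hg k) x (k + 1)) (integrable_mul_pow (hg k) y (k + 1))]
  congr 1
  ext t
  have h : x t * y t = 0 := by simpa using congrArg (fun u : C(K, ℂ) => u t) hxy
  rcases mul_eq_zero.mp h with h | h <;> simp [h]

end Fin5

/-- A holomorphic (i.e. complex Fréchet differentiable) function of bounded
type (i.e. bounded on bounded sets) on `C(K)` is orthogonally additive iff it
is a "power series function integrated against a measure": there are a finite
positive Borel measure `μ` on `K` and `gₖ ∈ L¹(μ)` (`k ≥ 1`) with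
`∑_{k ≥ 1} ‖gₖ‖_{L¹(μ)} rᵏ < ∞` for every `r > 0`, such that `∑ₖ gₖ xᵏ`
converges absolutely in `L¹(μ)` for every `x` and
`f x = ∫_K ∑_{k ≥ 1} gₖ(t) x(t)^k dμ(t)` for all `x ∈ C(K)`. -/
theorem orthAdd_iff_powerSeriesRepr
    {K : Type*} [TopologicalSpace K] [CompactSpace K] [T2Space K]
    [MeasurableSpace K] [BorelSpace K]
    (f : C(K, ℂ) → ℂ) (hf : Differentiable ℂ f)
    (hb : ∀ r : ℝ, 0 < r → ∃ C : ℝ, ∀ x : C(K, ℂ), ‖x‖ ≤ r → ‖f x‖ ≤ C) :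
    IsOrthAdd f ↔
      ∃ (μ : Measure K) (g : ℕ → K → ℂ),
        IsFiniteMeasure μ ∧
        (∀ k, 1 ≤ k → Integrable (g k) μ) ∧
        (∀ r : ℝ, 0 < r →
          Summable (fun k : ℕ => (∫ t, ‖g (k + 1) t‖ ∂μ) * r ^ (k + 1))) ∧
        (∀ x : C(K, ℂ),
          Summable (fun k : ℕ => ∫ t, ‖g (k + 1) t * (x t) ^ (k + 1)‖ ∂μ)) ∧
        (∀ x : C(K, ℂ), f x = ∫ t, (∑' k : ℕ, g (k + 1) t * (x t) ^ (k + 1)) ∂μ) := by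
  have hHB : HB f := ⟨hf, hb⟩
  constructor
  · intro ho
    obtain ⟨μ, g, hμ, hi, hn, hint⟩ := repr_of_orthAdd hHB ho
    have hsr : ∀ r : ℝ, 0 < r →
        Summable (fun k : ℕ => (∫ t, ‖g (k + 1) t‖ ∂μ) * r ^ (k + 1)) := by
      intro r hr
      refine Summable.of_nonneg_of_le (fun n => by positivity) (fun n => ?_)
        ((Phi_summable hHB ho r hr).mul_left 4)
      rw [← mul_assoc]
      exact mul_le_mul_of_nonneg_right (hn n) (by positivity)
    have hsx : ∀ x : C(K, ℂ),
        Summable (fun k : ℕ => ∫ t, ‖g (k + 1) t * (x t) ^ (k + 1)‖ ∂μ) := by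
      intro x
      refine Summable.of_nonneg_of_le (fun n => by positivity) (fun n => ?_)
        (hsr (‖x‖ + 1) (by positivity))
      rw [← integral_mul_const]
      refine integral_mono (integrable_mul_pow (hi n) x (n + 1)).norm
        ((hi n).norm.mul_const _) (fun t => ?_)
      simp only [norm_mul, norm_pow]
      gcongr
      linarith [x.norm_coe_le_norm t]
    refine ⟨μ, g, hμ, ?_, hsr, hsx, ?_⟩
    · intro k hk
      obtain ⟨m, rfl⟩ : ∃ m, k = m + 1 := ⟨k - 1, by omega⟩
      exact hi m
    · intro x
      have h1 := hasSum_integral_of_summable_integral_norm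
        (fun k => integrable_mul_pow (hi k) x (k + 1)) (hsx x)
      simp only [hint] at h1
      exact (Phi_hasSum hHB ho x).unique h1
  · rintro ⟨μ, g, hμ, hi, -, hsx, hr⟩
    exact orthAdd_of_repr (fun k => hi (k + 1) (by omega)) hsx hr
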